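/- For all n ≥ 0, B_{A_n} − A_n − B_n ∈ {−3, −2, −1, 0, 1} (as integers). -/

import Mathlib

/-- The substitution `h` with `h(1) = 110` and `h(0) = 11`. -/
def hsub : ℕ → List ℕ
  | 0 => [1, 1]
  | 1 => [1, 1, 0]
  | _ => []

/-- `h` extended to words by concatenation. -/
def happ (w : List ℕ) : List ℕ := w.flatMap hsub

/-- `K n = h^n(1)`. -/
def Kword (n : ℕ) : List ℕ := happ^[n] [1]

/-- The reachable states `(N - 2 * q, O N - 2 * O q, k (q+1), k (N+1))` with `|N - 2 * q| ≤ 2`. -/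
def Sst : List (ℤ × ℤ × ℕ × ℕ) :=
  [(-2, -4, 0, 1), (-2, -3, 0, 1), (-2, -3, 1, 1), (-2, -2, 0, 0), (-2, -2, 0, 1), (-2, -2, 1, 0),
   (-2, -2, 1, 1), (-2, -1, 0, 1), (-2, -1, 1, 1), (-2, 0, 1, 0), (-2, 0, 1, 1), (-1, -3, 0, 1),
   (-1, -2, 0, 0), (-1, -2, 0, 1), (-1, -2, 1, 0), (-1, -2, 1, 1), (-1, -1, 0, 1), (-1, -1, 1, 1),
   (-1, 0, 0, 0), (-1, 0, 1, 0), (-1, 0, 1, 1), (-1, 1, 1, 1), (0, -2, 0, 1), (0, -2, 1, 1),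
   (0, -1, 0, 1), (0, -1, 1, 1), (0, 0, 0, 0), (0, 0, 0, 1), (0, 0, 1, 0), (0, 0, 1, 1),
   (0, 1, 1, 1), (0, 2, 1, 0), (1, -1, 0, 1), (1, -1, 1, 1), (1, 0, 0, 0), (1, 0, 0, 1),
   (1, 0, 1, 0), (1, 0, 1, 1), (1, 1, 0, 1), (1, 1, 1, 1), (1, 2, 1, 0), (1, 2, 1, 1),
   (2, 0, 0, 0), (2, 0, 0, 1), (2, 0, 1, 1), (2, 1, 0, 1), (2, 1, 1, 1), (2, 2, 0, 0),
   (2, 2, 1, 0), (2, 2, 1, 1), (2, 3, 1, 1)]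

def ltr (r : ℕ) : ℕ := if r < 2 then 1 else 0

theorem Sst_closed : ∀ t ∈ Sst, ∀ r ∈ List.range (2 + t.2.2.1), ∀ s ∈ List.range (2 + t.2.2.2),
    (-2 ≤ 2 * t.1 + t.2.1 + (s : ℤ) - 2 * (r : ℤ) ∧ 2 * t.1 + t.2.1 + (s : ℤ) - 2 * (r : ℤ) ≤ 2) →
    ((2 * t.1 + t.2.1 + (s : ℤ) - 2 * (r : ℤ), 2 * t.1 + (s : ℤ) - 2 * (r : ℤ), ltr r, ltr s) :
      ℤ × ℤ × ℕ × ℕ) ∈ Sst := by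
  decide +kernel

theorem Sst_hi : ∀ t ∈ Sst, t.1 = 2 → 2 * (t.2.2.1 : ℤ) < t.2.1 + t.2.2.2 + 2 := by
  decide +kernel

theorem Sst_lo : ∀ t ∈ Sst, t.1 = -2 → t.2.1 ≤ 0 := by
  decide +kernel

theorem Sst_fin : ∀ t ∈ Sst, (t.1 = 0 ∨ t.1 = 1) → t.2.2.2 = 1 → -2 ≤ t.2.1 ∧ t.2.1 ≤ 2 := by
  decide +kernel

def Ocount (k : ℕ → ℕ) : ℕ → ℕ
  | 0 => 0
  | p + 1 => Ocount k p + k (p + 1)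

structure KFacts (k : ℕ → ℕ) : Prop where
  h01 : ∀ i, k (i + 1) = 0 ∨ k (i + 1) = 1
  k1 : k 1 = 1
  key1 : ∀ p, k (2 * p + Ocount k p + 1) = 1
  key2 : ∀ p, k (2 * p + Ocount k p + 2) = 1
  key3 : ∀ p, k (p + 1) = 1 → k (2 * p + Ocount k p + 3) = 0

theorem O_g {k : ℕ → ℕ} (h : KFacts k) (p : ℕ) :
    Ocount k (2 * p + Ocount k p) = 2 * p := by
  induction p with
  | zero => simp [Ocount]
  | succ p ih =>
    have e1 := h.key1 p
    have e2 := h.key2 p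
    have o1 : Ocount k (p + 1) = Ocount k p + k (p + 1) := rfl
    have s1 : Ocount k (2 * p + Ocount k p + 1) = _ + k (2 * p + Ocount k p + 1) := rfl
    have s2 : Ocount k (2 * p + Ocount k p + 2) = _ + k (2 * p + Ocount k p + 2) := rfl
    have s3 : Ocount k (2 * p + Ocount k p + 3) = _ + k (2 * p + Ocount k p + 3) := rfl
    rcases h.h01 p with h0 | h0
    · rw [o1, h0, show 2 * (p + 1) + (Ocount k p + 0) = 2 * p + Ocount k p + 2 by ring]
      omega
    · have e3 := h.key3 p h0
      rw [o1, h0, show 2 * (p + 1) + (Ocount k p + 1) = 2 * p + Ocount k p + 3 by ring]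
      omega

theorem dec {k : ℕ → ℕ} (h : KFacts k) (q : ℕ) :
    ∃ p r, q = 2 * p + Ocount k p + r ∧ r < 2 + k (p + 1) := by
  induction q with
  | zero => exact ⟨0, 0, by simp [Ocount], by omega⟩
  | succ q ih =>
    obtain ⟨p, r, e, hr⟩ := ih
    by_cases hh : r + 1 < 2 + k (p + 1)
    · exact ⟨p, r + 1, by omega, hh⟩
    · refine ⟨p + 1, 0, ?_, by omega⟩
      have o1 : Ocount k (p + 1) = Ocount k p + k (p + 1) := rfl
      omega

theorem dec2 {k : ℕ → ℕ} (h : KFacts k) (p r : ℕ) (hr : r < 2 + k (p + 1)) :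
    Ocount k (2 * p + Ocount k p + r) = 2 * p + r ∧ k (2 * p + Ocount k p + r + 1) = ltr r := by
  have e1 := h.key1 p
  have e2 := h.key2 p
  have s0 := O_g h p
  have s1 : Ocount k (2 * p + Ocount k p + 1) = _ + k (2 * p + Ocount k p + 1) := rfl
  have s2 : Ocount k (2 * p + Ocount k p + 2) = _ + k (2 * p + Ocount k p + 2) := rfl
  have h3 : r = 0 ∨ r = 1 ∨ r = 2 := by have := h.h01 p; omega
  rcases h3 with rfl | rfl | rfl
  · exact ⟨by simpa using s0, by simpa [ltr] using e1⟩
  · exact ⟨by omega, by simpa [ltr] using e2⟩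
  · have := h.h01 p
    exact ⟨by omega, by simpa [ltr] using h.key3 p (by omega)⟩

theorem O_mono (k : ℕ → ℕ) : Monotone (Ocount k) :=
  monotone_nat_of_le_succ fun n => Nat.le_add_right _ _

theorem inS {k : ℕ → ℕ} (h : KFacts k) : ∀ n q N : ℕ, q + N ≤ n →
    -2 ≤ (N : ℤ) - 2 * q → (N : ℤ) - 2 * q ≤ 2 →
    (((N : ℤ) - 2 * q, (Ocount k N : ℤ) - 2 * Ocount k q, k (q + 1), k (N + 1)) :
      ℤ × ℤ × ℕ × ℕ) ∈ Sst := by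
  intro n
  induction n using Nat.strong_induction_on with
  | _ n ih =>
  intro q N hn hl hu
  by_cases h0 : q + N = 0
  · have hq : q = 0 := by omega
    have hN : N = 0 := by omega
    subst hq hN
    simp only [Nat.zero_add, h.k1, Ocount]
    decide
  obtain ⟨p, r, e, hr⟩ := dec h q
  obtain ⟨p', r', e', hr'⟩ := dec h N
  obtain ⟨a1, a2⟩ := dec2 h p r hr
  obtain ⟨b1, b2⟩ := dec2 h p' r' hr'
  rw [← e] at a1 a2
  rw [← e'] at b1 b2
  have hpos : ∀ m, 1 ≤ m → 1 ≤ Ocount k m := fun m hm => by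
    have := O_mono k hm
    have h1 : Ocount k 1 = 0 + k 1 := rfl
    rw [h.k1] at h1
    omega
  have hp := h.h01 p
  have hp' := h.h01 p'
  have U1 : (p' : ℤ) - 2 * p ≤ 2 := by
    by_contra hc
    have := ih (p + (2 * p + 2)) (by omega) p (2 * p + 2) le_rfl (by push_cast; omega)
      (by push_cast; omega)
    have h2 := Sst_hi _ this (by push_cast; ring)
    have hm := O_mono k (show 2 * p + 2 + 1 ≤ p' by omega)
    have o1 : Ocount k (2 * p + 2 + 1) = Ocount k (2 * p + 2) + k (2 * p + 2 + 1) := rfl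
    simp only at h2
    omega
  have L1 : -2 ≤ (p' : ℤ) - 2 * p := by
    by_contra hc
    have := ih (p + (2 * p - 2)) (by omega) p (2 * p - 2) le_rfl (by omega) (by omega)
    have h2 := Sst_lo _ this (by simp only; omega)
    have hm := O_mono k (show p' + 1 ≤ 2 * p - 2 by omega)
    have o1 : Ocount k (p' + 1) = Ocount k p' + k (p' + 1) := rfl
    simp only at h2
    omega
  have hlt : p + p' < q + N := by
    have := hpos p
    have := hpos p'
    omega
  have := ih (p + p') (by omega) p p' le_rfl L1 U1
  have hS := Sst_closed _ this r (List.mem_range.2 hr) r' (List.mem_range.2 hr')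
  simp only at hS
  have E1 : (N : ℤ) - 2 * q = 2 * ((p' : ℤ) - 2 * p) + ((Ocount k p' : ℤ) - 2 * Ocount k p)
      + r' - 2 * r := by omega
  have E2 : (Ocount k N : ℤ) - 2 * Ocount k q = 2 * ((p' : ℤ) - 2 * p) + r' - 2 * r := by omega
  rw [E1, E2, a2, b2]
  exact hS ⟨by omega, by omega⟩

theorem Kword_succ (m : ℕ) : Kword (m + 1) = happ (Kword m) := by
  simp [Kword, Function.iterate_succ_apply']

theorem happ_append (u v : List ℕ) : happ (u ++ v) = happ u ++ happ v := by
  simp [happ]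

theorem Kword_mem (m : ℕ) : ∀ x ∈ Kword m, x = 0 ∨ x = 1 := by
  induction m with
  | zero => simp [Kword]
  | succ m ih =>
    intro x hx
    rw [Kword_succ, happ, List.mem_flatMap] at hx
    obtain ⟨y, hy, hx⟩ := hx
    rcases ih y hy with rfl | rfl <;> simp [hsub] at hx <;> tauto

theorem happ_length (w : List ℕ) (hw : ∀ x ∈ w, x = 0 ∨ x = 1) :
    (happ w).length = 2 * w.length + w.sum := by
  induction w with
  | nil => simp [happ]
  | cons a w ih =>
    have := ih fun x hx => hw x (List.mem_cons_of_mem _ hx)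
    have e : happ (a :: w) = hsub a ++ happ w := by simp [happ]
    rw [e, List.length_append, this]
    rcases hw a List.mem_cons_self with rfl | rfl <;> simp [hsub] <;> ring

theorem Kword_length (m : ℕ) : m + 1 ≤ (Kword m).length := by
  induction m with
  | zero => simp [Kword]
  | succ m ih =>
    rw [Kword_succ, happ_length _ (Kword_mem m)]
    omega

theorem kfacts (k : ℕ → ℕ)
    (hk : ∀ (m i : ℕ), i < (Kword m).length → k (i + 1) = (Kword m).getD i 0) : KFacts k := by
  have hk' : ∀ (m i : ℕ) (hi : i < (Kword m).length), k (i + 1) = (Kword m)[i] := by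
    intro m i hi
    rw [hk m i hi, List.getD_eq_getElem _ _ hi]
  have h01 : ∀ i, k (i + 1) = 0 ∨ k (i + 1) = 1 := by
    intro i
    have hi : i < (Kword i).length := Kword_length i
    rw [hk' i i hi]
    exact Kword_mem i _ (List.getElem_mem hi)
  have hsum : ∀ m p, p ≤ (Kword m).length → ((Kword m).take p).sum = Ocount k p := by
    intro m p
    induction p with
    | zero => simp [Ocount]
    | succ p ih =>
      intro hp
      rw [List.sum_take_succ _ _ hp, ih (by omega), Ocount, hk' m p hp]
  have split : ∀ p, ∃ u v, Kword (p + 1) = u ++ hsub (k (p + 1)) ++ v ∧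
      u.length = 2 * p + Ocount k p := by
    intro p
    have hp : p < (Kword p).length := Kword_length p
    refine ⟨happ ((Kword p).take p), happ ((Kword p).drop (p + 1)), ?_, ?_⟩
    · have e : Kword p = (Kword p).take p ++ [(Kword p)[p]] ++ (Kword p).drop (p + 1) := by
        simp
      rw [Kword_succ]
      conv_lhs => rw [e]
      rw [happ_append, happ_append, hk' p p hp]
      simp [happ]
    · rw [happ_length _ fun x hx => Kword_mem p x (List.mem_of_mem_take hx), hsum p p hp.le,
        List.length_take, min_eq_left hp.le]
  have get : ∀ p j, j < (hsub (k (p + 1))).length →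
      k (2 * p + Ocount k p + j + 1) = (hsub (k (p + 1))).getD j 0 := by
    intro p j hj
    obtain ⟨u, v, e, hu⟩ := split p
    rw [hk (p + 1) _ (by rw [e]; simp; omega), e, ← hu, List.append_assoc]
    rw [List.getD_append_right _ _ _ _ (by omega), List.getD_append _ _ _ _ (by omega)]
    congr 1
    omega
  refine ⟨h01, ?_, ?_, ?_, ?_⟩
  · have := hk 0 0 (by simp [Kword])
    simpa [Kword] using this
  · intro p
    have := get p 0
    rcases h01 p with h | h <;> rw [h] at this <;> simpa [hsub] using this
  · intro p
    have := get p 1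
    rcases h01 p with h | h <;> rw [h] at this <;> simpa [hsub] using this
  · intro p h
    have := get p 2
    rw [h] at this
    simpa [hsub] using this

theorem count1 {k : ℕ → ℕ} (h : KFacts k) (N : ℕ) :
    Nat.count (fun i => 1 ≤ i ∧ k i = 1) (N + 1) = Ocount k N := by
  induction N with
  | zero => simp [Nat.count_succ, Ocount]
  | succ N ih =>
    rw [Nat.count_succ, ih, Ocount]
    rcases h.h01 N with h | h <;> simp [h]

theorem count0 {k : ℕ → ℕ} (h : KFacts k) (N : ℕ) :
    Nat.count (fun i => 1 ≤ i ∧ k i = 0) (N + 1) + Ocount k N = N := by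
  induction N with
  | zero => simp [Nat.count_succ, Ocount]
  | succ N ih =>
    rw [Nat.count_succ, Ocount]
    rcases h.h01 N with h | h <;> simp [h] <;> omega

theorem inf1 {k : ℕ → ℕ} (h : KFacts k) : (setOf fun i => 1 ≤ i ∧ k i = 1).Infinite := by
  rw [Set.infinite_iff_exists_gt]
  intro a
  exact ⟨_, ⟨by omega, h.key1 a⟩, by omega⟩

theorem B_of_A
    (k : ℕ → ℕ)
    (hk : ∀ (m i : ℕ), i < (Kword m).length → k (i + 1) = (Kword m).getD i 0)
    (A B : ℕ → ℕ)
    (hA0 : A 0 = 0) (hB0 : B 0 = 0)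
    (hA : ∀ n : ℕ, 1 ≤ n → A n = Nat.nth (fun i => 1 ≤ i ∧ k i = 1) (n - 1))
    (hB : ∀ n : ℕ, 1 ≤ n → B n = Nat.nth (fun i => 1 ≤ i ∧ k i = 0) (n - 1)) :
    ∀ n : ℕ, (B (A n) : ℤ) - (A n : ℤ) - (B n : ℤ) ∈ ({-3, -2, -1, 0, 1} : Set ℤ) := by
  have h := kfacts k hk
  have hAn : ∀ n, 1 ≤ n → ∃ N, A n = N + 1 ∧ k (N + 1) = 1 ∧ Ocount k N + 1 = n := by
    intro n hn
    have hm := Nat.nth_mem_of_infinite (inf1 h) (n - 1)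
    have hc := Nat.count_nth_of_infinite (inf1 h) (n - 1)
    rw [← hA n hn] at hm hc
    obtain ⟨N, hN⟩ : ∃ N, A n = N + 1 := ⟨A n - 1, by omega⟩
    rw [hN] at hm hc
    rw [count1 h] at hc
    exact ⟨N, hN, hm.2, by omega⟩
  have hBn : ∀ n, B n = 2 * A n + n := by
    intro n
    rcases Nat.eq_zero_or_pos n with rfl | hn
    · simp [hA0, hB0]
    obtain ⟨N, e, e1, e2⟩ := hAn n hn
    have hz := h.key3 N e1
    have hO := (dec2 h N 2 (by omega)).1
    have hc := count0 h (2 * N + Ocount k N + 2)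
    rw [hO] at hc
    have hc' : Nat.count (fun i => 1 ≤ i ∧ k i = 0) (2 * N + Ocount k N + 3) = n - 1 := by
      rw [show 2 * N + Ocount k N + 3 = 2 * N + Ocount k N + 2 + 1 from rfl]
      omega
    rw [hB n hn, ← hc', Nat.nth_count (p := fun i => 1 ≤ i ∧ k i = 0) ⟨by omega, hz⟩]
    omega
  intro n
  rw [hBn, hBn]
  rcases Nat.eq_zero_or_pos n with rfl | hn
  · simp [hA0]
  obtain ⟨N, e, e1, e2⟩ := hAn n hn
  obtain ⟨M, f, f1, f2⟩ := hAn (A n) (by omega)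
  obtain ⟨p, r, g, hr⟩ := dec h M
  obtain ⟨g1, g2⟩ := dec2 h p r hr
  rw [← g] at g1 g2
  have hr2 : r < 2 := by
    by_contra hc
    simp [ltr, hc] at g2
    omega
  have hS := Sst_fin _ (inS h _ p N le_rfl (by omega) (by omega)) (by simp only; omega) e1
  simp only at hS
  simp only [Set.mem_insert_iff, Set.mem_singleton_iff]
  push_cast
  omega
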